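/- For every n ≥ 2, the set Ir(Δⁿ) of irreducible elements of the simplex Δⁿ under the Bayesian order, equipped with the order dual to the Bayesian order, is order-isomorphic to the poset P{1, …, n} ∖ {∅} of nonempty subsets of {1, …, n} ordered by inclusion. -/

import Mathlib

/-- `x` is a classical `n`-state: a point of the simplex
`Δⁿ = {x ∈ [0,1]ⁿ : Σᵢ xᵢ = 1}`. -/
def IsClassicalState (n : ℕ) (x : Fin n → ℝ) : Prop :=
  (∀ i, x i ∈ Set.Icc (0 : ℝ) 1) ∧ ∑ i, x i = 1

/-- The Bayesian projection `pᵢ : Δ^{n+1} ⇀ Δⁿ`: remove coordinate `i` and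
renormalize.  (It is intended to be applied only when `x i ≠ 1`.) -/
noncomputable def bayesProj {n : ℕ} (i : Fin (n + 1)) (x : Fin (n + 1) → ℝ) : Fin n → ℝ :=
  fun j => (1 - x i)⁻¹ * x (i.succAbove j)

/-- The Bayesian order on classical states, defined inductively: on `Δ²`,
`x ⊑ y` iff `(y₁ ≤ x₁ ≤ 1/2)` or `(1/2 ≤ x₁ ≤ y₁)`; on `Δ^{n+1}` (`n ≥ 2`),
`x ⊑ y` iff `pᵢ x ⊑ pᵢ y` whenever both projections are defined. -/
def BayesLE : (n : ℕ) → (Fin n → ℝ) → (Fin n → ℝ) → Prop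
  | 0, _, _ => True
  | 1, _, _ => True
  | 2, x, y => (y 0 ≤ x 0 ∧ x 0 ≤ 1 / 2) ∨ (1 / 2 ≤ x 0 ∧ x 0 ≤ y 0)
  | n + 3, x, y =>
      ∀ i : Fin (n + 3), x i ≠ 1 → y i ≠ 1 →
        BayesLE (n + 2) (bayesProj i x) (bayesProj i y)

/-- `x` is a maximal element of `Δⁿ` under the Bayesian order. -/
def BayesMaximal (n : ℕ) (x : Fin n → ℝ) : Prop :=
  IsClassicalState n x ∧ ∀ y, IsClassicalState n y → BayesLE n x y → y = x

/-- `x` is the infimum (in `Δⁿ`, for the Bayesian order) of the set `S`. -/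
def BayesIsInfOf (n : ℕ) (x : Fin n → ℝ) (S : Set (Fin n → ℝ)) : Prop :=
  (∀ y ∈ S, BayesLE n x y) ∧
  ∀ z, IsClassicalState n z → (∀ y ∈ S, BayesLE n z y) → BayesLE n z x

/-- `x` is irreducible: `x` is the infimum of the set
of maximal elements above it. -/
def BayesIrred (n : ℕ) (x : Fin n → ℝ) : Prop :=
  BayesIsInfOf n x {y | BayesMaximal n y ∧ BayesLE n x y}

/-- The Bayesian order restricted to a pair of coordinates, with values `a, b` in the smaller
state and `c, d` in the larger one. -/
def BayesPairLE (a b c d : ℝ) : Prop :=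
  (a ≤ b ∧ c ≤ d ∧ c * b ≤ a * d) ∨ (b ≤ a ∧ d ≤ c ∧ d * a ≤ b * c)

namespace BayesPairLE

variable {a b c d : ℝ}

theorem symm (h : BayesPairLE a b c d) : BayesPairLE b a d c :=
  Or.symm h

theorem diag (a c : ℝ) : BayesPairLE a a c c :=
  Or.inl ⟨le_rfl, le_rfl, (mul_comm c a).le⟩

theorem zero_left (c d : ℝ) : BayesPairLE 0 0 c d := by
  rcases le_total c d with h | h
  · exact Or.inl ⟨le_rfl, h, by simp⟩
  · exact Or.inr ⟨le_rfl, h, by simp⟩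

theorem zero_right (a b : ℝ) : BayesPairLE a b 0 0 := by
  rcases le_total a b with h | h
  · exact Or.inl ⟨h, le_rfl, by simp⟩
  · exact Or.inr ⟨h, le_rfl, by simp⟩

theorem mul_iff {s t : ℝ} (hs : 0 < s) (ht : 0 < t) :
    BayesPairLE (s * a) (s * b) (t * c) (t * d) ↔ BayesPairLE a b c d := by
  have key : ∀ p q u v : ℝ, t * p * (s * q) ≤ s * u * (t * v) ↔ p * q ≤ u * v := by
    intro p q u v
    rw [show t * p * (s * q) = s * t * (p * q) by ring,
      show s * u * (t * v) = s * t * (u * v) by ring, mul_le_mul_iff_right₀ (mul_pos hs ht)]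
  simp only [BayesPairLE, mul_le_mul_iff_right₀ hs, mul_le_mul_iff_right₀ ht, key]

theorem iff_of_add_eq_one (hab : a + b = 1) (hcd : c + d = 1) :
    BayesPairLE a b c d ↔ (c ≤ a ∧ a ≤ 1 / 2) ∨ (1 / 2 ≤ a ∧ a ≤ c) := by
  obtain rfl : b = 1 - a := by linarith
  obtain rfl : d = 1 - c := by linarith
  constructor
  · rintro (⟨h, -, h'⟩ | ⟨h, -, h'⟩)
    · exact Or.inl ⟨by linarith, by linarith⟩
    · exact Or.inr ⟨by linarith, by linarith⟩
  · rintro (⟨h, h'⟩ | ⟨h, h'⟩)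
    · exact Or.inl ⟨by linarith, by linarith, by linarith⟩
    · exact Or.inr ⟨by linarith, by linarith, by linarith⟩

end BayesPairLE

namespace IsClassicalState

theorem of_nonneg {n : ℕ} {x : Fin n → ℝ} (h : ∀ i, 0 ≤ x i) (hs : ∑ i, x i = 1) :
    IsClassicalState n x :=
  ⟨fun i => ⟨h i, hs ▸ Finset.single_le_sum (fun j _ => h j) (Finset.mem_univ i)⟩, hs⟩

theorem nonneg {n : ℕ} {x : Fin n → ℝ} (hx : IsClassicalState n x) (i : Fin n) : 0 ≤ x i :=
  (hx.1 i).1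

theorem sub_pos {n : ℕ} {x : Fin n → ℝ} (hx : IsClassicalState n x) {i : Fin n}
    (hi : x i ≠ 1) : 0 < 1 - x i :=
  _root_.sub_pos.2 (lt_of_le_of_ne (hx.1 i).2 hi)

theorem bayesProj {n : ℕ} {x : Fin (n + 1) → ℝ} (hx : IsClassicalState (n + 1) x)
    {i : Fin (n + 1)} (hi : x i ≠ 1) : IsClassicalState n (bayesProj i x) := by
  have hpos := hx.sub_pos hi
  refine of_nonneg (fun j => mul_nonneg (inv_nonneg.2 hpos.le) (hx.nonneg _)) ?_
  have hs := hx.2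
  rw [Fin.sum_univ_succAbove _ i] at hs
  simp only [_root_.bayesProj]
  rw [← Finset.mul_sum, ← eq_sub_of_add_eq' hs, inv_mul_cancel₀]
  rw [eq_sub_of_add_eq' hs]
  exact hpos.ne'

theorem eq_zero_of_eq_one {n : ℕ} {x : Fin n → ℝ} (hx : IsClassicalState n x) {i j : Fin n}
    (hi : x i = 1) (hij : j ≠ i) : x j = 0 := by
  have h := Finset.add_le_sum (fun k _ => hx.nonneg k) (Finset.mem_univ i) (Finset.mem_univ j)
    hij.symm
  rw [hx.2, hi] at h
  linarith [hx.nonneg j]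

end IsClassicalState

/-- The Bayesian order is determined by its restrictions to pairs of coordinates. -/
theorem bayesLE_iff_pairwise (n : ℕ) {x y : Fin (n + 2) → ℝ} (hx : IsClassicalState (n + 2) x)
    (hy : IsClassicalState (n + 2) y) :
    BayesLE (n + 2) x y ↔ ∀ i j, BayesPairLE (x i) (x j) (y i) (y j) := by
  induction n with
  | zero =>
    have hxs := hx.2
    have hys := hy.2
    rw [Fin.sum_univ_two] at hxs hys
    change (y 0 ≤ x 0 ∧ x 0 ≤ 1 / 2) ∨ (1 / 2 ≤ x 0 ∧ x 0 ≤ y 0) ↔ _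
    rw [← BayesPairLE.iff_of_add_eq_one hxs hys]
    refine ⟨fun h => ?_, fun h => h 0 1⟩
    rw [Fin.forall_fin_two, Fin.forall_fin_two, Fin.forall_fin_two]
    exact ⟨⟨.diag _ _, h⟩, h.symm, .diag _ _⟩
  | succ n ih =>
    change (∀ k : Fin (n + 3), x k ≠ 1 → y k ≠ 1 →
      BayesLE (n + 2) (bayesProj k x) (bayesProj k y)) ↔ _
    have hproj : ∀ k : Fin (n + 3), x k ≠ 1 → y k ≠ 1 →
        (BayesLE (n + 2) (bayesProj k x) (bayesProj k y) ↔
          ∀ i j, BayesPairLE (x (k.succAbove i)) (x (k.succAbove j))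
            (y (k.succAbove i)) (y (k.succAbove j))) := by
      intro k hxk hyk
      rw [ih (hx.bayesProj hxk) (hy.bayesProj hyk)]
      simp only [bayesProj,
        BayesPairLE.mul_iff (inv_pos.2 (hx.sub_pos hxk)) (inv_pos.2 (hy.sub_pos hyk))]
    constructor
    · intro h i j
      obtain ⟨k, hki, hkj⟩ := Fin.exists_ne_and_ne_of_two_lt i j (by omega)
      by_cases hxk : x k = 1
      · rw [hx.eq_zero_of_eq_one hxk hki.symm, hx.eq_zero_of_eq_one hxk hkj.symm]
        exact .zero_left _ _
      by_cases hyk : y k = 1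
      · rw [hy.eq_zero_of_eq_one hyk hki.symm, hy.eq_zero_of_eq_one hyk hkj.symm]
        exact .zero_right _ _
      obtain ⟨i, rfl⟩ := Fin.exists_succAbove_eq hki.symm
      obtain ⟨j, rfl⟩ := Fin.exists_succAbove_eq hkj.symm
      exact (hproj k hxk hyk).1 (h k hxk hyk) i j
    · exact fun h k hxk hyk => (hproj k hxk hyk).2 fun i j => h _ _

theorem bayesLE_iff {n : ℕ} (hn : 2 ≤ n) {x y : Fin n → ℝ} (hx : IsClassicalState n x)
    (hy : IsClassicalState n y) :
    BayesLE n x y ↔ ∀ i j, BayesPairLE (x i) (x j) (y i) (y j) := by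
  obtain ⟨m, rfl⟩ := Nat.exists_eq_add_of_le' hn
  exact bayesLE_iff_pairwise m hx hy

/-- The set of coordinates at which `x` attains its maximum. -/
noncomputable def modes {n : ℕ} (x : Fin n → ℝ) : Finset (Fin n) :=
  open Classical in Finset.univ.filter fun k => ∀ i, x i ≤ x k

theorem mem_modes {n : ℕ} {x : Fin n → ℝ} {k : Fin n} : k ∈ modes x ↔ ∀ i, x i ≤ x k := by
  simp [modes]

theorem IsClassicalState.modes_nonempty {n : ℕ} {x : Fin n → ℝ} (hx : IsClassicalState n x) :
    (modes x).Nonempty := by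
  have : Nonempty (Fin n) := by
    by_contra h
    rw [not_nonempty_iff] at h
    simpa using hx.2
  obtain ⟨k, hk⟩ := Finite.exists_max x
  exact ⟨k, mem_modes.2 hk⟩

/-- The uniform distribution on `S`. -/
noncomputable def uniformState {n : ℕ} (S : Finset (Fin n)) : Fin n → ℝ :=
  fun i => if i ∈ S then (S.card : ℝ)⁻¹ else 0

section uniformState

variable {n : ℕ} {S : Finset (Fin n)}

theorem uniformState_of_mem {i : Fin n} (hi : i ∈ S) : uniformState S i = (S.card : ℝ)⁻¹ :=
  if_pos hi

theorem uniformState_of_notMem {i : Fin n} (hi : i ∉ S) : uniformState S i = 0 :=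
  if_neg hi

theorem isClassicalState_uniformState (hS : S.Nonempty) :
    IsClassicalState n (uniformState S) := by
  refine .of_nonneg (fun i => ?_) ?_
  · unfold uniformState
    split_ifs <;> positivity
  · have : (S.card : ℝ) ≠ 0 := by exact_mod_cast hS.card_ne_zero
    simp [uniformState, this]

theorem inv_card_pos (hS : S.Nonempty) : (0 : ℝ) < (S.card : ℝ)⁻¹ :=
  inv_pos.2 (by exact_mod_cast hS.card_pos)

theorem modes_uniformState (hS : S.Nonempty) : modes (uniformState S) = S := by
  have hpos := inv_card_pos hS
  ext k
  rw [mem_modes]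
  constructor
  · intro h
    by_contra hk
    obtain ⟨j, hj⟩ := hS
    have := h j
    rw [uniformState_of_mem hj, uniformState_of_notMem hk] at this
    linarith
  · intro hk i
    rw [uniformState_of_mem hk]
    unfold uniformState
    split_ifs
    exacts [le_rfl, hpos.le]

theorem bayesLE_uniformState_iff (hn : 2 ≤ n) {x : Fin n → ℝ} (hx : IsClassicalState n x)
    (hS : S.Nonempty) : BayesLE n x (uniformState S) ↔ S ⊆ modes x := by
  have hpos := inv_card_pos hS
  rw [bayesLE_iff hn hx (isClassicalState_uniformState hS)]
  constructor
  · intro h k hk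
    refine mem_modes.2 fun i => ?_
    have hki := h i k
    rw [uniformState_of_mem hk] at hki
    rcases hki with ⟨h₁, -⟩ | ⟨h₁, h₂, h₃⟩
    · exact h₁
    · by_cases hi : i ∈ S
      · rw [uniformState_of_mem hi, mul_comm] at h₃
        exact le_of_mul_le_mul_right h₃ hpos
      · rw [uniformState_of_notMem hi] at h₂
        linarith
  · intro h
    have hmem : ∀ i j, j ∈ S → BayesPairLE (x i) (x j) (uniformState S i) (uniformState S j) := by
      intro i j hj
      rw [uniformState_of_mem hj]
      have hij := mem_modes.1 (h hj) i
      by_cases hi : i ∈ S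
      · rw [uniformState_of_mem hi, le_antisymm hij (mem_modes.1 (h hi) j)]
        exact .diag _ _
      · rw [uniformState_of_notMem hi]
        exact Or.inl ⟨hij, hpos.le, by simpa using mul_nonneg (hx.nonneg i) hpos.le⟩
    intro i j
    by_cases hj : j ∈ S
    · exact hmem i j hj
    by_cases hi : i ∈ S
    · exact (hmem j i hi).symm
    rw [uniformState_of_notMem hi, uniformState_of_notMem hj]
    exact .zero_right _ _

theorem eq_uniformState_modes_of_le (hn : 2 ≤ n) {x : Fin n → ℝ} (hx : IsClassicalState n x)
    (h : BayesLE n (uniformState (modes x)) x) : x = uniformState (modes x) := by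
  have hne := hx.modes_nonempty
  have hpos := inv_card_pos hne
  rw [bayesLE_iff hn (isClassicalState_uniformState hne) hx] at h
  obtain ⟨k, hk⟩ := hne
  have hform : ∀ i, x i = if i ∈ modes x then x k else 0 := by
    intro i
    split_ifs with hi
    · exact le_antisymm (mem_modes.1 hk i) (mem_modes.1 hi k)
    · have hik := h i k
      rw [uniformState_of_mem hk, uniformState_of_notMem hi] at hik
      rcases hik with ⟨-, -, h'⟩ | ⟨h', -⟩
      · rw [zero_mul] at h'
        exact le_antisymm (nonpos_of_mul_nonpos_left h' hpos) (hx.nonneg i)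
      · linarith
  have hsum := hx.2
  rw [Finset.sum_congr rfl fun i _ => hform i, Finset.sum_ite_mem, Finset.univ_inter,
    Finset.sum_const, nsmul_eq_mul] at hsum
  funext i
  rw [hform i, uniformState, eq_inv_of_mul_eq_one_right hsum]

end uniformState

theorem bayesMaximal_iff {n : ℕ} (hn : 2 ≤ n) {x : Fin n → ℝ} :
    BayesMaximal n x ↔ ∃ k, x = uniformState {k} := by
  constructor
  · rintro ⟨hx, hmax⟩
    obtain ⟨k, hk⟩ := hx.modes_nonempty
    have hS := Finset.singleton_nonempty k
    exact ⟨k, (hmax _ (isClassicalState_uniformState hS)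
      ((bayesLE_uniformState_iff hn hx hS).2 (Finset.singleton_subset_iff.2 hk))).symm⟩
  · rintro ⟨k, rfl⟩
    have hS := Finset.singleton_nonempty k
    refine ⟨isClassicalState_uniformState hS, fun y hy h => ?_⟩
    have hz : ∀ i, i ≠ k → y i = 0 := by
      intro i hi
      have hik := (bayesLE_iff hn (isClassicalState_uniformState hS) hy).1 h i k
      rw [uniformState_of_mem (Finset.mem_singleton_self k),
        uniformState_of_notMem (Finset.notMem_singleton.2 hi)] at hik
      rcases hik with ⟨-, -, h'⟩ | ⟨h', -⟩
      · exact le_antisymm (by simpa using h') (hy.nonneg i)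
      · norm_num at h'
    have hk : y k = 1 := by
      rw [← hy.2, Finset.sum_eq_single k (fun i _ hi => hz i hi) (by simp)]
    funext i
    by_cases hi : i = k
    · subst hi
      simpa [uniformState] using hk
    · rw [hz i hi, uniformState_of_notMem (Finset.notMem_singleton.2 hi)]

theorem bayesLE_maximals_above_iff {n : ℕ} (hn : 2 ≤ n) {x z : Fin n → ℝ}
    (hx : IsClassicalState n x) (hz : IsClassicalState n z) :
    (∀ y ∈ {y | BayesMaximal n y ∧ BayesLE n x y}, BayesLE n z y) ↔ modes x ⊆ modes z := by
  simp only [Set.mem_ofPred_eq, bayesMaximal_iff hn]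
  constructor
  · intro h k hk
    have hS := Finset.singleton_nonempty k
    simpa [bayesLE_uniformState_iff hn hz hS] using h (uniformState {k})
      ⟨⟨k, rfl⟩, (bayesLE_uniformState_iff hn hx hS).2 (Finset.singleton_subset_iff.2 hk)⟩
  · rintro h _ ⟨⟨k, rfl⟩, hk⟩
    have hS := Finset.singleton_nonempty k
    rw [bayesLE_uniformState_iff hn hx hS] at hk
    exact (bayesLE_uniformState_iff hn hz hS).2 (hk.trans h)

theorem bayesIrred_uniformState {n : ℕ} (hn : 2 ≤ n) {S : Finset (Fin n)} (hS : S.Nonempty) :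
    BayesIrred n (uniformState S) := by
  have hu := isClassicalState_uniformState hS
  refine ⟨fun y hy => hy.2, fun z hz h => ?_⟩
  rw [bayesLE_maximals_above_iff hn hu hz, modes_uniformState hS] at h
  exact (bayesLE_uniformState_iff hn hz hS).2 h

theorem BayesIrred.eq_uniformState_modes {n : ℕ} (hn : 2 ≤ n) {x : Fin n → ℝ}
    (hx : IsClassicalState n x) (h : BayesIrred n x) : x = uniformState (modes x) := by
  have hu := isClassicalState_uniformState hx.modes_nonempty
  refine eq_uniformState_modes_of_le hn hx (h.2 _ hu ?_)
  rw [bayesLE_maximals_above_iff hn hx hu, modes_uniformState hx.modes_nonempty]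

/-- For `n ≥ 2`, the irreducible elements of `Δⁿ` under the Bayesian order, with
the dual order, are order-isomorphic to the nonempty subsets of `{1,…,n}`
ordered by inclusion. -/
theorem irred_dual_orderIso_nonempty_subsets (n : ℕ) (hn : 2 ≤ n) :
    ∃ e : {x : Fin n → ℝ // IsClassicalState n x ∧ BayesIrred n x} ≃
          {S : Finset (Fin n) // S.Nonempty},
      ∀ x y : {x : Fin n → ℝ // IsClassicalState n x ∧ BayesIrred n x},
        BayesLE n y.1 x.1 ↔ (e x).1 ⊆ (e y).1 := by
  refine ⟨⟨fun x => ⟨modes x.1, x.2.1.modes_nonempty⟩,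
    fun S => ⟨uniformState S.1, isClassicalState_uniformState S.2, bayesIrred_uniformState hn S.2⟩,
    fun x => Subtype.ext (x.2.2.eq_uniformState_modes hn x.2.1).symm,
    fun S => Subtype.ext (modes_uniformState S.2)⟩, fun x y => ?_⟩
  change BayesLE n y.1 x.1 ↔ modes x.1 ⊆ modes y.1
  conv_lhs => rw [x.2.2.eq_uniformState_modes hn x.2.1]
  exact bayesLE_uniformState_iff hn y.2.1 x.2.1.modes_nonempty
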